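/- arXiv:2410.06621 — 8 statements merged into one kernel-verified Lean document; each statement's English description precedes it below -/
import Mathlib

section
/- Define ε = min over all pairs (i,j) of min( log(pX i) / log(p i j), log(pY j) / log(p i j) ). Then 0 ≤ ε ≤ 1 and I(X;Y) ≤ I^SI(X;Y) ≤ I(X;Y) + (1 − ε) · H(X,Y). -/
open Real Finset

/-- Theorem 3.2 of SI2E: with ε the minimum over all pairs (i,j) of
min(log(pX i)/log(p i j), log(pY j)/log(p i j)), we have 0 ≤ ε ≤ 1 and
I(X;Y) ≤ I^SI(X;Y) ≤ I(X;Y) + (1 − ε)·H(X,Y). -/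
theorem stmt_0 (n : ℕ) (hn : 1 ≤ n) (p : Fin n → Fin n → ℝ)
    (hp0 : ∀ i j, 0 < p i j) (hp1 : ∀ i j, p i j < 1)
    (hsum : ∑ i, ∑ j, p i j = 1)
    (pX pY : Fin n → ℝ)
    (hpX : ∀ i, pX i = ∑ j, p i j)
    (hpY : ∀ j, pY j = ∑ i, p i j)
    (H I ISI ε : ℝ)
    (hH : H = -∑ i, ∑ j, p i j * Real.log (p i j))
    (hI : I = ∑ i, ∑ j, p i j * Real.log (p i j / (pX i * pY j)))
    (hISI : ISI = ∑ i, ∑ j, p i j * Real.log (2 / (pX i + pY j)))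
    (hε : ε = Finset.univ.inf' (Finset.univ_nonempty_iff.mpr ⟨(⟨0, hn⟩, ⟨0, hn⟩)⟩)
      (fun ij : Fin n × Fin n =>
        min (Real.log (pX ij.1) / Real.log (p ij.1 ij.2))
            (Real.log (pY ij.2) / Real.log (p ij.1 ij.2)))) :
    0 ≤ ε ∧ ε ≤ 1 ∧ I ≤ ISI ∧ ISI ≤ I + (1 - ε) * H := by
  have hx0 : ∀ i j, p i j ≤ pX i := fun i j => by
    rw [hpX]
    exact Finset.single_le_sum (f := fun j => p i j) (fun k _ => (hp0 i k).le) (Finset.mem_univ j)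
  have hy0 : ∀ i j, p i j ≤ pY j := fun i j => by
    rw [hpY]
    exact Finset.single_le_sum (f := fun i => p i j) (fun k _ => (hp0 k j).le) (Finset.mem_univ i)
  have hx1 : ∀ i, pX i ≤ 1 := fun i => by
    rw [hpX, ← hsum]
    exact Finset.single_le_sum (f := fun i => ∑ j, p i j)
      (fun k _ => Finset.sum_nonneg fun l _ => (hp0 k l).le) (Finset.mem_univ i)
  have hy1 : ∀ j, pY j ≤ 1 := fun j => by
    rw [hpY, ← hsum, Finset.sum_comm]
    exact Finset.single_le_sum (f := fun j => ∑ i, p i j)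
      (fun k _ => Finset.sum_nonneg fun l _ => (hp0 l k).le) (Finset.mem_univ j)
  have hxp : ∀ i j : Fin n, 0 < pX i := fun i j => (hp0 i j).trans_le (hx0 i j)
  have hyp : ∀ i j : Fin n, 0 < pY j := fun i j => (hp0 i j).trans_le (hy0 i j)
  have hlog : ∀ i j, Real.log (p i j) < 0 := fun i j => Real.log_neg (hp0 i j) (hp1 i j)
  have hεle : ∀ i j, ε ≤ min (Real.log (pX i) / Real.log (p i j))
      (Real.log (pY j) / Real.log (p i j)) := fun i j => by
    rw [hε]
    exact Finset.inf'_le (fun ij : Fin n × Fin n =>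
        min (Real.log (pX ij.1) / Real.log (p ij.1 ij.2))
            (Real.log (pY ij.2) / Real.log (p ij.1 ij.2))) (Finset.mem_univ (i, j))
  have hεx : ∀ i j, Real.log (pX i) ≤ ε * Real.log (p i j) := fun i j =>
    (le_div_iff_of_neg (hlog i j)).1 ((hεle i j).trans (min_le_left _ _))
  have hεy : ∀ i j, Real.log (pY j) ≤ ε * Real.log (p i j) := fun i j =>
    (le_div_iff_of_neg (hlog i j)).1 ((hεle i j).trans (min_le_right _ _))
  refine ⟨?_, ?_, ?_, ?_⟩
  · rw [hε]
    refine Finset.le_inf' _ _ fun ij _ => le_min ?_ ?_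
    · exact div_nonneg_of_nonpos
        (Real.log_nonpos (hxp ij.1 ij.2).le (hx1 _)) (hlog _ _).le
    · exact div_nonneg_of_nonpos
        (Real.log_nonpos (hyp ij.1 ij.2).le (hy1 _)) (hlog _ _).le
  · refine ((hεle ⟨0, hn⟩ ⟨0, hn⟩).trans (min_le_left _ _)).trans ?_
    rw [div_le_one_of_neg (hlog _ _)]
    exact Real.log_le_log (hp0 _ _) (hx0 _ _)
  · rw [hI, hISI]
    refine Finset.sum_le_sum fun i _ => Finset.sum_le_sum fun j _ =>
      mul_le_mul_of_nonneg_left ?_ (hp0 i j).le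
    have hx := hxp i j
    have hy := hyp i j
    apply Real.log_le_log (div_pos (hp0 i j) (mul_pos hx hy))
    rw [div_le_div_iff₀ (mul_pos hx hy) (add_pos hx hy)]
    nlinarith [mul_le_mul_of_nonneg_right (hx0 i j) hy.le,
      mul_le_mul_of_nonneg_right (hy0 i j) hx.le]
  · rw [hI, hISI, hH, ← Finset.sum_neg_distrib, Finset.mul_sum, ← Finset.sum_add_distrib]
    refine Finset.sum_le_sum fun i _ => ?_
    rw [← Finset.sum_neg_distrib, Finset.mul_sum, ← Finset.sum_add_distrib]
    refine Finset.sum_le_sum fun j _ => ?_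
    have hx := hxp i j
    have hy := hyp i j
    have key : Real.log 2 + Real.log (pX i) + Real.log (pY j) - Real.log (pX i + pY j)
        ≤ ε * Real.log (p i j) := by
      rcases le_total (pX i) (pY j) with h | h
      · have : Real.log (2 * pX i) ≤ Real.log (pX i + pY j) :=
          Real.log_le_log (by positivity) (by linarith)
        rw [Real.log_mul two_ne_zero hx.ne'] at this
        linarith [hεy i j]
      · have : Real.log (2 * pY j) ≤ Real.log (pX i + pY j) :=
          Real.log_le_log (by positivity) (by linarith)
        rw [Real.log_mul two_ne_zero hy.ne'] at this
        linarith [hεx i j]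
    rw [Real.log_div two_ne_zero (add_pos hx hy).ne',
      Real.log_div (hp0 i j).ne' (mul_pos hx hy).ne', Real.log_mul hx.ne' hy.ne']
    have := mul_le_mul_of_nonneg_left key (hp0 i j).le
    linarith
end

section
/- I(X;Y) ≤ I^SI(X;Y); moreover every summand of the difference is nonnegative, i.e. p i j · log( (2 · pX i · pY j) / ((pX i + pY j) · p i j) ) ≥ 0 for all i, j. -/
open Real Finset

/-- I(X;Y) ≤ I^SI(X;Y); moreover every summand of the difference is nonnegative:
p i j · log((2·pX i·pY j)/((pX i + pY j)·p i j)) ≥ 0 for all i, j. -/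
theorem stmt_1 (n : ℕ) (hn : 1 ≤ n) (p : Fin n → Fin n → ℝ)
    (hp0 : ∀ i j, 0 < p i j) (hp1 : ∀ i j, p i j < 1)
    (hsum : ∑ i, ∑ j, p i j = 1)
    (pX pY : Fin n → ℝ)
    (hpX : ∀ i, pX i = ∑ j, p i j)
    (hpY : ∀ j, pY j = ∑ i, p i j)
    (I ISI : ℝ)
    (hI : I = ∑ i, ∑ j, p i j * Real.log (p i j / (pX i * pY j)))
    (hISI : ISI = ∑ i, ∑ j, p i j * Real.log (2 / (pX i + pY j))) :
    I ≤ ISI ∧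
      ∀ i j, 0 ≤ p i j * Real.log ((2 * pX i * pY j) / ((pX i + pY j) * p i j)) := by
  have hx : ∀ i j, p i j ≤ pX i := fun i j => by
    rw [hpX]
    exact Finset.single_le_sum (f := fun j => p i j) (fun k _ => (hp0 i k).le) (Finset.mem_univ j)
  have hy : ∀ i j, p i j ≤ pY j := fun i j => by
    rw [hpY]
    exact Finset.single_le_sum (f := fun i => p i j) (fun k _ => (hp0 k j).le) (Finset.mem_univ i)
  have key : ∀ i j, (pX i + pY j) * p i j ≤ 2 * pX i * pY j := fun i j => by
    have h0 := hp0 i j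
    have h1 := hx i j
    have h2 := hy i j
    have h3 : pX i * p i j ≤ pX i * pY j := mul_le_mul_of_nonneg_left h2 (by linarith)
    have h4 : pY j * p i j ≤ pY j * pX i := mul_le_mul_of_nonneg_left h1 (by linarith)
    linarith
  constructor
  · rw [hI, hISI]
    refine Finset.sum_le_sum fun i _ => Finset.sum_le_sum fun j _ => ?_
    have h0 := hp0 i j
    have h1 : 0 < pX i := h0.trans_le (hx i j)
    have h2 : 0 < pY j := h0.trans_le (hy i j)
    refine mul_le_mul_of_nonneg_left (Real.log_le_log (by positivity) ?_) h0.le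
    rw [div_le_div_iff₀ (by positivity) (by positivity)]
    linarith [key i j]
  · intro i j
    have h0 := hp0 i j
    have h1 : 0 < pX i := h0.trans_le (hx i j)
    have h2 : 0 < pY j := h0.trans_le (hy i j)
    refine mul_nonneg h0.le (Real.log_nonneg ?_)
    rw [le_div_iff₀ (by positivity)]
    linarith [key i j]
end

section
/- I^SI(X;Y) ≤ I(X;Y) + H(X,Y). -/
open Real Finset

/-- I^SI(X;Y) ≤ I(X;Y) + H(X,Y). -/
theorem stmt_4 (n : ℕ) (hn : 1 ≤ n) (p : Fin n → Fin n → ℝ)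
    (hp0 : ∀ i j, 0 < p i j) (hp1 : ∀ i j, p i j < 1)
    (hsum : ∑ i, ∑ j, p i j = 1)
    (pX pY : Fin n → ℝ)
    (hpX : ∀ i, pX i = ∑ j, p i j)
    (hpY : ∀ j, pY j = ∑ i, p i j)
    (H I ISI : ℝ)
    (hH : H = -∑ i, ∑ j, p i j * Real.log (p i j))
    (hI : I = ∑ i, ∑ j, p i j * Real.log (p i j / (pX i * pY j)))
    (hISI : ISI = ∑ i, ∑ j, p i j * Real.log (2 / (pX i + pY j))) :
    ISI ≤ I + H := by
  have : Nonempty (Fin n) := ⟨⟨0, hn⟩⟩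
  have hX0 : ∀ i, 0 < pX i := fun i => by
    rw [hpX]; exact Finset.sum_pos (fun j _ => hp0 i j) Finset.univ_nonempty
  have hY0 : ∀ j, 0 < pY j := fun j => by
    rw [hpY]; exact Finset.sum_pos (fun i _ => hp0 i j) Finset.univ_nonempty
  have hX1 : ∀ i, pX i ≤ 1 := fun i => by
    rw [← hsum]
    simp only [← hpX]
    exact Finset.single_le_sum (f := pX) (fun k _ => (hX0 k).le) (Finset.mem_univ i)
  have hY1 : ∀ j, pY j ≤ 1 := fun j => by
    rw [← hsum, Finset.sum_comm]
    simp only [← hpY]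
    exact Finset.single_le_sum (f := pY) (fun k _ => (hY0 k).le) (Finset.mem_univ j)
  rw [hH, hI, hISI, ← sub_eq_add_neg, ← Finset.sum_sub_distrib]
  refine Finset.sum_le_sum fun i _ => ?_
  rw [← Finset.sum_sub_distrib]
  refine Finset.sum_le_sum fun j _ => ?_
  have ha := hX0 i
  have hb := hY0 j
  have ha1 := hX1 i
  have hb1 := hY1 j
  have hab : 0 < pX i * pY j := mul_pos ha hb
  rw [← mul_sub]
  refine mul_le_mul_of_nonneg_left ?_ (hp0 i j).le
  rw [Real.log_div (hp0 i j).ne' hab.ne']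
  have key : Real.log (2 / (pX i + pY j)) ≤ Real.log (pX i * pY j)⁻¹ := by
    apply Real.log_le_log (by positivity)
    rw [inv_eq_one_div, div_le_div_iff₀ (by positivity) hab]
    nlinarith [mul_nonneg ha.le (sub_nonneg.2 hb1), mul_nonneg hb.le (sub_nonneg.2 ha1)]
  rw [Real.log_inv] at key
  linarith
end

section
/- Under a one-to-one correspondence between X and Y, the structural mutual information equals the traditional mutual information, and both equal the marginal entropy: I^SI(X;Y) = I(X;Y) = H(X) = ∑_i p i i · log(1 / p i i). -/
open Real Finset

/-- Under a one-to-one correspondence between X and Y (p i j = 0 for i ≠ j),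
the structural mutual information equals the traditional mutual information,
and both equal the marginal entropy H(X) = ∑_i p i i · log(1/p i i).
(With p i j = 0 off the diagonal, the convention 0·log x = 0 makes the full
double sums agree with the sums restricted to terms with p i j > 0.) -/
theorem stmt_5 (n : ℕ) (hn : 1 ≤ n) (p : Fin n → Fin n → ℝ)
    (hdiag : ∀ i, 0 < p i i)
    (hoff : ∀ i j, i ≠ j → p i j = 0)
    (hsum : ∑ i, p i i = 1)
    (pX pY : Fin n → ℝ)
    (hpX : ∀ i, pX i = ∑ j, p i j)
    (hpY : ∀ j, pY j = ∑ i, p i j)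
    (HX I ISI : ℝ)
    (hHX : HX = -∑ i, pX i * Real.log (pX i))
    (hI : I = ∑ i, ∑ j, p i j * Real.log (p i j / (pX i * pY j)))
    (hISI : ISI = ∑ i, ∑ j, p i j * Real.log (2 / (pX i + pY j))) :
    ISI = I ∧ I = HX ∧ HX = ∑ i, p i i * Real.log (1 / p i i) := by
  have hX : ∀ i, pX i = p i i := fun i => by
    rw [hpX]
    exact Finset.sum_eq_single i (fun j _ h => hoff i j h.symm) (by simp)
  have hY : ∀ i, pY i = p i i := fun i => by
    rw [hpY]
    exact Finset.sum_eq_single i (fun j _ h => hoff j i h) (by simp)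
  have hd : ∀ f : Fin n → Fin n → ℝ, ∑ i, ∑ j, p i j * f i j = ∑ i, p i i * f i i := by
    intro f
    refine Finset.sum_congr rfl fun i _ => ?_
    exact Finset.sum_eq_single i (fun j _ h => by rw [hoff i j h.symm, zero_mul]) (by simp)
  have h1 : ISI = ∑ i, p i i * Real.log (1 / p i i) := by
    rw [hISI, hd (fun i j => Real.log (2 / (pX i + pY j)))]
    refine Finset.sum_congr rfl fun i _ => ?_
    have h := (hdiag i).ne'
    have e : 2 / (pX i + pY i) = 1 / p i i := by
      rw [hX, hY, ← two_mul]
      field_simp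
    simp only [e]
  have h2 : I = ∑ i, p i i * Real.log (1 / p i i) := by
    rw [hI, hd (fun i j => Real.log (p i j / (pX i * pY j)))]
    refine Finset.sum_congr rfl fun i _ => ?_
    have h := (hdiag i).ne'
    have e : p i i / (pX i * pY i) = 1 / p i i := by
      rw [hX, hY]
      field_simp
    simp only [e]
  have h3 : HX = ∑ i, p i i * Real.log (1 / p i i) := by
    rw [hHX, ← Finset.sum_neg_distrib]
    refine Finset.sum_congr rfl fun i _ => ?_
    rw [hX, one_div, Real.log_inv, mul_neg]
  exact ⟨h1.trans h2.symm, h2.trans h3.symm, h3⟩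
end

section
/- Assume 0 ≤ g k ≤ vol k for all k, and define ζ = min over i of ( log( p i / vol (B i) ) / log(p i) ). Then 0 ≤ ζ ≤ 1 and ζ · H(V0) ≤ H(V0) − H(V1) ≤ H^T ≤ H(V0). -/
open Real Finset

/-- Theorem 4.3: with 0 ≤ g k ≤ vol k and ζ the minimum over i of
log(p i / vol (B i)) / log(p i), we have 0 ≤ ζ ≤ 1 and
ζ·H(V0) ≤ H(V0) − H(V1) ≤ H^T ≤ H(V0). -/
theorem stmt_8 (n m : ℕ) (hn : 1 ≤ n) (hm : 1 ≤ m)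
    (B : Fin n → Fin m) (hB : Function.Surjective B)
    (p : Fin n → ℝ)
    (hp0 : ∀ i, 0 < p i) (hp1 : ∀ i, p i < 1)
    (hsum : ∑ i, p i = 1)
    (vol : Fin m → ℝ)
    (hvol : ∀ k, vol k = ∑ i ∈ Finset.univ.filter (fun i => B i = k), p i)
    (g : Fin m → ℝ) (hg : ∀ k, 0 ≤ g k ∧ g k ≤ vol k)
    (H0 H1 HT ζ : ℝ)
    (hH0 : H0 = -∑ i, p i * Real.log (p i))
    (hH1 : H1 = -∑ k, vol k * Real.log (vol k))
    (hHT : HT = -∑ k, g k * Real.log (vol k) - ∑ i, p i * Real.log (p i / vol (B i)))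
    (hζ : ζ = Finset.univ.inf' (Finset.univ_nonempty_iff.mpr ⟨⟨0, hn⟩⟩)
      (fun i : Fin n => Real.log (p i / vol (B i)) / Real.log (p i))) :
    0 ≤ ζ ∧ ζ ≤ 1 ∧ ζ * H0 ≤ H0 - H1 ∧ H0 - H1 ≤ HT ∧ HT ≤ H0 := by
  have hpv : ∀ i, p i ≤ vol (B i) := by
    intro i
    rw [hvol]
    exact Finset.single_le_sum (f := p) (fun j _ => (hp0 j).le) (by simp)
  have hvpos : ∀ k, 0 < vol k := by
    intro k
    obtain ⟨i, rfl⟩ := hB k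
    exact (hp0 i).trans_le (hpv i)
  have hv1 : ∀ k, vol k ≤ 1 := by
    intro k
    rw [hvol, ← hsum]
    exact Finset.sum_le_sum_of_subset_of_nonneg (Finset.filter_subset _ _)
      (fun j _ _ => (hp0 j).le)
  have hlv : ∀ k, Real.log (vol k) ≤ 0 := fun k => Real.log_nonpos (hvpos k).le (hv1 k)
  have hlp : ∀ i, Real.log (p i) < 0 := fun i => Real.log_neg (hp0 i) (hp1 i)
  have hdiv : ∀ i, Real.log (p i / vol (B i)) = Real.log (p i) - Real.log (vol (B i)) :=
    fun i => Real.log_div (hp0 i).ne' (hvpos _).ne'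
  have hswap : ∑ i, p i * Real.log (vol (B i)) = ∑ k, vol k * Real.log (vol k) := by
    rw [← Finset.sum_fiberwise Finset.univ B]
    refine Finset.sum_congr rfl fun k _ => ?_
    rw [hvol k, Finset.sum_mul, ← hvol k]
    refine Finset.sum_congr rfl fun i hi => ?_
    rw [(Finset.mem_filter.mp hi).2]
  have hS : ∑ i, p i * Real.log (p i / vol (B i))
      = ∑ i, p i * Real.log (p i) - ∑ k, vol k * Real.log (vol k) := by
    rw [← hswap, ← Finset.sum_sub_distrib]
    refine Finset.sum_congr rfl fun i _ => ?_
    rw [hdiv, mul_sub]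
  have hζi : ∀ i, ζ ≤ Real.log (p i / vol (B i)) / Real.log (p i) := by
    intro i
    rw [hζ]
    exact Finset.inf'_le (fun i : Fin n => Real.log (p i / vol (B i)) / Real.log (p i))
      (Finset.mem_univ i)
  have hg1 : ∑ k, vol k * Real.log (vol k) ≤ ∑ k, g k * Real.log (vol k) :=
    Finset.sum_le_sum fun k _ => mul_le_mul_of_nonpos_right (hg k).2 (hlv k)
  have hg0 : ∑ k, g k * Real.log (vol k) ≤ 0 :=
    Finset.sum_nonpos fun k _ => mul_nonpos_of_nonneg_of_nonpos (hg k).1 (hlv k)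
  refine ⟨?_, ?_, ?_, ?_, ?_⟩
  · rw [hζ]
    refine Finset.le_inf' _ _ fun i _ => ?_
    refine div_nonneg_of_nonpos ?_ (hlp i).le
    exact Real.log_nonpos (div_nonneg (hp0 i).le (hvpos _).le)
      ((div_le_one (hvpos _)).2 (hpv i))
  · refine (hζi ⟨0, hn⟩).trans ?_
    rw [div_le_one_of_neg (hlp _), hdiv]
    linarith [hlv (B ⟨0, hn⟩)]
  · have h : ∑ i, p i * Real.log (p i / vol (B i)) ≤ ∑ i, ζ * (p i * Real.log (p i)) := by
      refine Finset.sum_le_sum fun i _ => ?_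
      have h1 := (le_div_iff_of_neg (hlp i)).1 (hζi i)
      have h2 := mul_le_mul_of_nonneg_left h1 (hp0 i).le
      linarith
    rw [← Finset.mul_sum, hS] at h
    rw [hH0, hH1]
    linarith
  · rw [hH0, hH1, hHT, hS]
    linarith
  · rw [hH0, hHT, hS]
    linarith
end

section
/- With ζ = min over i of ( log( p i / vol (B i) ) / log(p i) ), the sub-community entropy is bounded as H(V1) ≤ (1 − ζ) · H(V0). -/
open Real Finset

/-- With ζ the minimum over i of log(p i / vol (B i)) / log(p i), the
sub-community entropy is bounded as H(V1) ≤ (1 − ζ)·H(V0). -/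
theorem stmt_9 (n m : ℕ) (hn : 1 ≤ n) (hm : 1 ≤ m)
    (B : Fin n → Fin m) (hB : Function.Surjective B)
    (p : Fin n → ℝ)
    (hp0 : ∀ i, 0 < p i) (hp1 : ∀ i, p i < 1)
    (hsum : ∑ i, p i = 1)
    (vol : Fin m → ℝ)
    (hvol : ∀ k, vol k = ∑ i ∈ Finset.univ.filter (fun i => B i = k), p i)
    (H0 H1 ζ : ℝ)
    (hH0 : H0 = -∑ i, p i * Real.log (p i))
    (hH1 : H1 = -∑ k, vol k * Real.log (vol k))
    (hζ : ζ = Finset.univ.inf' (Finset.univ_nonempty_iff.mpr ⟨⟨0, hn⟩⟩)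
      (fun i : Fin n => Real.log (p i / vol (B i)) / Real.log (p i))) :
    H1 ≤ (1 - ζ) * H0 := by
  have hv : ∀ i, 0 < vol (B i) := by
    intro i
    rw [hvol]
    exact Finset.sum_pos (fun j _ => hp0 j) ⟨i, by simp⟩
  have h1 : ∑ k, vol k * Real.log (vol k) = ∑ i, p i * Real.log (vol (B i)) := by
    rw [← Finset.sum_fiberwise Finset.univ B (fun i => p i * Real.log (vol (B i)))]
    refine Finset.sum_congr rfl fun k _ => ?_
    conv_lhs => rw [hvol k, Finset.sum_mul, ← hvol k]
    refine Finset.sum_congr rfl fun i hi => ?_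
    rw [(Finset.mem_filter.mp hi).2]
  have key : ∀ i, (1 - ζ) * (p i * Real.log (p i)) ≤ p i * Real.log (vol (B i)) := by
    intro i
    have hl : Real.log (p i) < 0 := Real.log_neg (hp0 i) (hp1 i)
    have hz : ζ ≤ Real.log (p i / vol (B i)) / Real.log (p i) := by
      rw [hζ]
      exact Finset.inf'_le (fun i : Fin n => Real.log (p i / vol (B i)) / Real.log (p i))
        (Finset.mem_univ i)
    rw [le_div_iff_of_neg hl, Real.log_div (hp0 i).ne' (hv i).ne'] at hz
    nlinarith [mul_le_mul_of_nonneg_left hz (hp0 i).le]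
  have h2 := Finset.sum_le_sum fun i (_ : i ∈ Finset.univ) => key i
  rw [← Finset.mul_sum] at h2
  rw [hH1, hH0, h1]
  linarith
end

section
/- If 0 ≤ g k ≤ vol k for all k, then H^T ≤ H(V0); that is, the value-conditional structural entropy never exceeds the Shannon entropy of the visitation distribution. -/
open Real Finset

/-- If 0 ≤ g k ≤ vol k for all k, then the value-conditional structural
entropy H^T never exceeds the Shannon entropy H(V0) of the visitation
distribution. -/
theorem stmt_11 (n m : ℕ) (hn : 1 ≤ n) (hm : 1 ≤ m)
    (B : Fin n → Fin m) (hB : Function.Surjective B)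
    (p : Fin n → ℝ)
    (hp0 : ∀ i, 0 < p i) (hp1 : ∀ i, p i < 1)
    (hsum : ∑ i, p i = 1)
    (vol : Fin m → ℝ)
    (hvol : ∀ k, vol k = ∑ i ∈ Finset.univ.filter (fun i => B i = k), p i)
    (g : Fin m → ℝ) (hg : ∀ k, 0 ≤ g k ∧ g k ≤ vol k)
    (H0 HT : ℝ)
    (hH0 : H0 = -∑ i, p i * Real.log (p i))
    (hHT : HT = -∑ k, g k * Real.log (vol k) - ∑ i, p i * Real.log (p i / vol (B i))) :
    HT ≤ H0 := by
  have hvpos : ∀ k, 0 < vol k := by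
    intro k
    obtain ⟨i, hi⟩ := hB k
    rw [hvol k]
    exact Finset.sum_pos (fun j _ => hp0 j) ⟨i, by simp [hi]⟩
  have hvle : ∀ k, vol k ≤ 1 := by
    intro k
    rw [hvol k, ← hsum]
    exact Finset.sum_le_sum_of_subset_of_nonneg (Finset.filter_subset _ _)
      (fun j _ _ => (hp0 j).le)
  have h1 : ∑ i, p i * Real.log (p i / vol (B i))
      = ∑ i, p i * Real.log (p i) - ∑ i, p i * Real.log (vol (B i)) := by
    rw [← Finset.sum_sub_distrib]
    refine Finset.sum_congr rfl fun i _ => ?_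
    rw [Real.log_div (hp0 i).ne' (hvpos _).ne', mul_sub]
  have h2 : ∑ i, p i * Real.log (vol (B i)) = ∑ k, vol k * Real.log (vol k) := by
    rw [← Finset.sum_fiberwise (s := Finset.univ) (g := B)]
    refine Finset.sum_congr rfl fun k _ => ?_
    conv_rhs => rw [hvol k, Finset.sum_mul, ← hvol k]
    refine Finset.sum_congr rfl fun i hi => ?_
    rw [(Finset.mem_filter.mp hi).2]
  have h3 : ∑ k, vol k * Real.log (vol k) ≤ ∑ k, g k * Real.log (vol k) :=
    Finset.sum_le_sum fun k _ =>
      mul_le_mul_of_nonpos_right (hg k).2 (Real.log_nonpos (hvpos k).le (hvle k))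
  rw [hHT, hH0, h1, h2]
  linarith
end

section
/- For every permutation σ of Fin n: H^SI(X) + H^SI(Y) − H^{T^σ}(X,Y) = ∑_i p (σ i) i · log( 2 / (pX (σ i) + pY i) ). -/
open Real Finset

/-- For every permutation σ (a one-to-one matching of x-vertices to y-vertices
in a 2-layer approximate binary encoding tree T^σ):
H^SI(X) + H^SI(Y) − H^{T^σ}(X,Y) = ∑_i p (σ i) i · log(2 / (pX (σ i) + pY i)). -/
theorem stmt_12 (n : ℕ) (hn : 1 ≤ n) (p : Fin n → Fin n → ℝ)
    (hp0 : ∀ i j, 0 < p i j) (hp1 : ∀ i j, p i j < 1)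
    (hsum : ∑ i, ∑ j, p i j = 1)
    (pX pY : Fin n → ℝ)
    (hpX : ∀ i, pX i = ∑ j, p i j)
    (hpY : ∀ j, pY j = ∑ i, p i j)
    (σ : Equiv.Perm (Fin n))
    (HSIX HSIY HT : ℝ)
    (hHSIX : HSIX = -∑ i, (pX i / 2) * Real.log (pX i / 2))
    (hHSIY : HSIY = -∑ j, (pY j / 2) * Real.log (pY j / 2))
    (hHT : HT = -∑ i,
      (((pX (σ i) + pY i - 2 * p (σ i) i) / 2) * Real.log ((pX (σ i) + pY i) / 2)
        + (pX (σ i) / 2) * Real.log (pX (σ i) / (pX (σ i) + pY i))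
        + (pY i / 2) * Real.log (pY i / (pX (σ i) + pY i)))) :
    HSIX + HSIY - HT = ∑ i, p (σ i) i * Real.log (2 / (pX (σ i) + pY i)) := by
  have hX : ∀ i, 0 < pX i := fun i => by
    rw [hpX]
    exact Finset.sum_pos (fun j _ => hp0 i j) ⟨i, Finset.mem_univ i⟩
  have hY : ∀ j, 0 < pY j := fun j => by
    rw [hpY]
    exact Finset.sum_pos (fun i _ => hp0 i j) ⟨j, Finset.mem_univ j⟩
  have hre : ∑ i, (pX i / 2) * Real.log (pX i / 2)
      = ∑ i, (pX (σ i) / 2) * Real.log (pX (σ i) / 2) :=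
    (Equiv.sum_comp σ (fun i => (pX i / 2) * Real.log (pX i / 2))).symm
  rw [hHSIX, hHSIY, hHT, hre, sub_neg_eq_add, ← Finset.sum_neg_distrib,
    ← Finset.sum_neg_distrib, ← Finset.sum_add_distrib, ← Finset.sum_add_distrib]
  refine Finset.sum_congr rfl fun i _ => ?_
  have h1 := (hX (σ i)).ne'
  have h2 := (hY i).ne'
  have h3 := (add_pos (hX (σ i)) (hY i)).ne'
  have h4 : (2 : ℝ) ≠ 0 := two_ne_zero
  rw [Real.log_div h1 h4, Real.log_div h2 h4, Real.log_div h3 h4, Real.log_div h1 h3,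
    Real.log_div h2 h3, Real.log_div h4 h3]
  ring
end
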